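/- Let N ≥ 1 be an integer, p > 1 with p ≠ 1 + 2/N, and T ∈ (0,∞). There exists a constant γ > 0 depending only on N and p such that: if μ is a nonnegative Radon measure on ℝ^N and u : ℝ^N × (0,T) → [0,∞) is measurable and satisfies, for every t ∈ (0,T) and almost every x ∈ ℝ^N, u(x,t) < ∞ and u(x,t) ≥ ∫_{ℝ^N} Γ_2(x−y,t) dμ(y) + ∫_0^t ∫_{ℝ^N} Γ_2(x−y,t−s) u(y,s)^p dy ds, then μ(B(z,σ)) ≤ γ σ^{N − 2/(p−1)} for every z ∈ ℝ^N and every σ ∈ (0, T^{1/2}). -/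

import Mathlib

open MeasureTheory Real Set

/-- The Gauss–Weierstrass heat kernel `Γ₂(x,t) = (4πt)^{-N/2} exp(-|x|²/(4t))` on `ℝ^N`. -/
noncomputable def heatKernel (N : ℕ) (x : EuclideanSpace ℝ (Fin N)) (t : ℝ) : ℝ :=
  (4 * Real.pi * t) ^ (-(N:ℝ)/2) * Real.exp (-‖x‖^2 / (4*t))

abbrev HE (N : ℕ) := EuclideanSpace ℝ (Fin N)

lemma hk_pos (N : ℕ) (x : HE N) {t : ℝ} (ht : 0 < t) : 0 < heatKernel N x t := by
  unfold heatKernel; positivity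

lemma hk_meas (N : ℕ) : Measurable (fun q : HE N × ℝ => heatKernel N q.1 q.2) := by
  unfold heatKernel; fun_prop

lemma gauss_l (N : ℕ) {b : ℝ} (hb : 0 < b) (m : HE N) :
    ∫⁻ y : HE N, ENNReal.ofReal (Real.exp (-b * ‖y - m‖^2)) =
      ENNReal.ofReal ((Real.pi / b) ^ ((N:ℝ)/2)) := by
  rw [lintegral_sub_right_eq_self (fun y : HE N => ENNReal.ofReal (Real.exp (-b * ‖y‖^2))) m]
  have h := GaussianFourier.integral_rexp_neg_mul_sq_norm (V := HE N) hb
  rw [finrank_euclideanSpace_fin] at h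
  rw [← h, ofReal_integral_eq_lintegral_ofReal]
  · by_contra hc
    rw [integral_undef hc] at h
    have : 0 < (Real.pi / b) ^ ((N:ℝ)/2) := by positivity
    linarith
  · exact Filter.Eventually.of_forall fun _ => (Real.exp_pos _).le

lemma hk_semi (N : ℕ) {a b : ℝ} (ha : 0 < a) (hb : 0 < b) (x w : HE N) :
    ∫⁻ y : HE N, ENNReal.ofReal (heatKernel N (x - y) a) * ENNReal.ofReal (heatKernel N (y - w) b)
      = ENNReal.ofReal (heatKernel N (x - w) (a + b)) := by
  set m : HE N := (b / (a+b)) • x + (a/(a+b)) • w with hm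
  set d : ℝ := (a+b)/(4*a*b) with hd
  have hab : 0 < a + b := by positivity
  have hdp : 0 < d := by positivity
  have key : ∀ y : HE N, -‖x - y‖^2/(4*a) + -‖y - w‖^2/(4*b) =
      -‖x - w‖^2/(4*(a+b)) + -d * ‖y - m‖^2 := by
    intro y
    have e1 : x - w = (x - y) + (y - w) := by abel
    have e2 : y - m = (a/(a+b)) • (y - w) - (b/(a+b)) • (x - y) := by
      have : y = (a/(a+b)) • y + (b/(a+b)) • y := by
        rw [← add_smul, ← add_div, div_self hab.ne', one_smul]
      rw [smul_sub, smul_sub, hm]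
      nth_rewrite 1 [this]
      abel
    rw [e1, e2]
    generalize x - y = X
    generalize y - w = Y
    rw [norm_add_sq_real, norm_sub_sq_real, norm_smul, norm_smul, inner_smul_left, inner_smul_right,
      real_inner_comm, mul_pow, mul_pow, Real.norm_eq_abs, Real.norm_eq_abs, sq_abs, sq_abs, hd]
    simp only [conj_trivial]
    field_simp
    ring
  have h1 : ∀ y : HE N, ENNReal.ofReal (heatKernel N (x - y) a) *
      ENNReal.ofReal (heatKernel N (y - w) b) =
      ENNReal.ofReal ((4 * Real.pi * a) ^ (-(N:ℝ)/2) * (4 * Real.pi * b) ^ (-(N:ℝ)/2) *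
        Real.exp (-‖x - w‖^2/(4*(a+b)))) * ENNReal.ofReal (Real.exp (-d * ‖y - m‖^2)) := by
    intro y
    rw [← ENNReal.ofReal_mul (hk_pos N _ ha).le, ← ENNReal.ofReal_mul (by positivity)]
    congr 1
    rw [mul_assoc _ (rexp _), ← Real.exp_add, ← key, Real.exp_add]
    unfold heatKernel
    ring
  simp_rw [h1]
  rw [lintegral_const_mul _ (by fun_prop), gauss_l N hdp, ← ENNReal.ofReal_mul (by positivity)]
  congr 1
  unfold heatKernel
  have h2 : (4 * Real.pi * a) ^ (-(N:ℝ)/2) * (4 * Real.pi * b) ^ (-(N:ℝ)/2) *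
      (Real.pi / d) ^ ((N:ℝ)/2) = (4 * Real.pi * (a+b)) ^ (-(N:ℝ)/2) := by
    have : (Real.pi / d) ^ ((N:ℝ)/2) = ((Real.pi / d)⁻¹) ^ (-(N:ℝ)/2) := by
      rw [neg_div, Real.rpow_neg (by positivity), Real.inv_rpow (by positivity), inv_inv]
    rw [this, ← Real.mul_rpow (by positivity) (by positivity),
      ← Real.mul_rpow (by positivity) (by positivity)]
    congr 1
    rw [hd]; field_simp
  rw [← h2]; ring

lemma hk_one (N : ℕ) {a : ℝ} (ha : 0 < a) (x : HE N) :
    ∫⁻ y : HE N, ENNReal.ofReal (heatKernel N (x - y) a) = 1 := by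
  have h1 : ∀ y : HE N, ENNReal.ofReal (heatKernel N (x - y) a) =
      ENNReal.ofReal ((4 * Real.pi * a) ^ (-(N:ℝ)/2)) *
        ENNReal.ofReal (Real.exp (-(1/(4*a)) * ‖y - x‖^2)) := by
    intro y
    rw [← ENNReal.ofReal_mul (by positivity), norm_sub_rev]
    unfold heatKernel
    congr 3
    rw [norm_sub_rev]; ring
  simp_rw [h1]
  rw [lintegral_const_mul _ (by fun_prop), gauss_l N (by positivity),
    ← ENNReal.ofReal_mul (by positivity), neg_div, Real.rpow_neg (by positivity)]
  have : Real.pi / (1/(4*a)) = 4 * Real.pi * a := by field_simp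
  rw [this, inv_mul_cancel₀ (by positivity), ENNReal.ofReal_one]

lemma jensen {α : Type*} [MeasurableSpace α] (ν : Measure α) (g f : α → ENNReal)
    (hg : Measurable g) (hf : Measurable f) (h1 : ∫⁻ y, g y ∂ν = 1) {q : ℝ} (hq : 1 ≤ q) :
    (∫⁻ y, g y * f y ∂ν) ^ q ≤ ∫⁻ y, g y * f y ^ q ∂ν := by
  have e : ∀ h : α → ENNReal, Measurable h → ∫⁻ y, g y * h y ∂ν = ∫⁻ y, h y ∂(ν.withDensity g) := by
    intro h hh
    rw [lintegral_withDensity_eq_lintegral_mul _ hg hh]; rfl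
  have : IsProbabilityMeasure (ν.withDensity g) := ⟨by simp [withDensity_apply, h1]⟩
  rw [e f hf, e _ (hf.pow_const q)]
  have := eLpNorm'_le_eLpNorm'_of_exponent_le (f := f) (p := 1) (q := q) one_pos hq
    (ν.withDensity g) hf.aestronglyMeasurable
  simp only [eLpNorm', enorm_eq_self, ENNReal.rpow_one, div_one] at this
  have h2 := ENNReal.rpow_le_rpow this (z := q) (by linarith)
  rwa [← ENNReal.rpow_mul, one_div, inv_mul_cancel₀ (by linarith), ENNReal.rpow_one] at h2

noncomputable def VV (N : ℕ) (μ : Measure (HE N)) (x : HE N) (t : ℝ) : ENNReal :=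
  ∫⁻ y, ENNReal.ofReal (heatKernel N (x - y) t) ∂μ

lemma VV_meas (N : ℕ) (μ : Measure (HE N)) [SFinite μ] (t : ℝ) : Measurable (fun x => VV N μ x t) := by
  unfold VV
  apply Measurable.lintegral_prod_right' (f := fun q : HE N × HE N =>
    ENNReal.ofReal (heatKernel N (q.1 - q.2) t))
  exact ((hk_meas N).comp (by fun_prop : Measurable (fun q : HE N × HE N => (q.1 - q.2, t)))).ennreal_ofReal

lemma hk_meas2 (N : ℕ) (x : HE N) (t : ℝ) :
    Measurable (fun y => ENNReal.ofReal (heatKernel N (x - y) t)) :=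
  ((hk_meas N).comp (by fun_prop : Measurable (fun y : HE N => (x - y, t)))).ennreal_ofReal

lemma VV_semi (N : ℕ) (μ : Measure (HE N)) [SFinite μ] {a b : ℝ} (ha : 0 < a) (hb : 0 < b) (x : HE N) :
    ∫⁻ y, ENNReal.ofReal (heatKernel N (x - y) a) * VV N μ y b = VV N μ x (a + b) := by
  have m1 : ∀ c, Measurable (fun q : HE N × HE N => ENNReal.ofReal (heatKernel N (q.1 - q.2) c)) :=
    fun c => ((hk_meas N).comp
      (by fun_prop : Measurable (fun q : HE N × HE N => (q.1 - q.2, c)))).ennreal_ofReal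
  unfold VV
  have : ∀ y : HE N, ENNReal.ofReal (heatKernel N (x - y) a) *
      ∫⁻ w, ENNReal.ofReal (heatKernel N (y - w) b) ∂μ =
      ∫⁻ w, ENNReal.ofReal (heatKernel N (x - y) a) * ENNReal.ofReal (heatKernel N (y - w) b) ∂μ := by
    intro y
    rw [lintegral_const_mul]
    exact hk_meas2 N y b
  simp_rw [this]
  rw [lintegral_lintegral_swap]
  · simp_rw [hk_semi N ha hb]
  · exact (((hk_meas2 N x a).comp measurable_fst).mul (m1 b)).aemeasurable

/-- one step of the iteration -/
lemma step (N : ℕ) {p T : ℝ} (hp : 1 < p) (μ : Measure (HE N)) [SFinite μ] (u : HE N → ℝ → ℝ)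
    (hu0 : ∀ x : HE N, ∀ t ∈ Set.Ioo (0:ℝ) T, 0 ≤ u x t)
    (hu : ∀ t ∈ Set.Ioo (0:ℝ) T, ∀ᵐ x : HE N,
          (∫⁻ y, ENNReal.ofReal (heatKernel N (x - y) t) ∂μ) +
            (∫⁻ s in Set.Ioo (0:ℝ) t, ∫⁻ y,
              ENNReal.ofReal (heatKernel N (x - y) (t - s)) * ENNReal.ofReal (u y s ^ p)) ≤
            ENNReal.ofReal (u x t))
    {c A q : ℝ} (hc : 0 ≤ c) (hA : 0 ≤ A) (hq : 1 ≤ q)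
    (ih : ∀ t ∈ Set.Ioo (0:ℝ) T, ∀ᵐ x : HE N,
      ENNReal.ofReal (c * t ^ A) * VV N μ x t ^ q ≤ ENNReal.ofReal (u x t)) :
    ∀ t ∈ Set.Ioo (0:ℝ) T, ∀ᵐ x : HE N,
      ENNReal.ofReal (c ^ p / (p * A + 1) * t ^ (p * A + 1)) * VV N μ x t ^ (p * q) ≤
        ENNReal.ofReal (u x t) := by
  intro t ht
  filter_upwards [hu t ht] with x hx
  refine le_trans ?_ (le_trans le_add_self hx)
  have hp0 : 0 ≤ p := by linarith
  have hpA : 0 ≤ p * A := by positivity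
  have hin : ∀ s ∈ Set.Ioo (0:ℝ) t, ENNReal.ofReal (c ^ p * s ^ (p * A)) * VV N μ x t ^ (p * q) ≤
      ∫⁻ y, ENNReal.ofReal (heatKernel N (x - y) (t - s)) * ENNReal.ofReal (u y s ^ p) := by
    intro s hs
    have hsT : s ∈ Set.Ioo (0:ℝ) T := ⟨hs.1, hs.2.trans ht.2⟩
    have hts : 0 < t - s := by linarith [hs.2]
    calc _ ≤ ENNReal.ofReal (c ^ p * s ^ (p * A)) *
          ∫⁻ y, ENNReal.ofReal (heatKernel N (x - y) (t - s)) * VV N μ y s ^ (p * q) := by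
          gcongr
          have := VV_semi N μ hts hs.1 x
          rw [sub_add_cancel] at this
          rw [← this]
          exact jensen _ _ _ (hk_meas2 N x _) (VV_meas N μ s) (hk_one N hts x) (by nlinarith)
      _ = ∫⁻ y, ENNReal.ofReal (heatKernel N (x - y) (t - s)) *
            (ENNReal.ofReal (c ^ p * s ^ (p * A)) * VV N μ y s ^ (p * q)) := by
          rw [← lintegral_const_mul]
          · congr 1; ext y; ring
          · exact (hk_meas2 N x _).mul ((VV_meas N μ s).pow_const _)
      _ ≤ _ := by
          apply lintegral_mono_ae
          filter_upwards [ih s hsT] with y hy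
          gcongr
          have := ENNReal.rpow_le_rpow hy hp0
          rw [ENNReal.ofReal_rpow_of_nonneg (hu0 y s hsT) hp0] at this
          refine le_trans (le_of_eq ?_) this
          have hs0 := hs.1.le
          rw [ENNReal.mul_rpow_of_nonneg _ _ hp0, ← ENNReal.rpow_mul, mul_comm q p,
            ENNReal.ofReal_rpow_of_nonneg (by positivity) hp0, Real.mul_rpow hc (by positivity),
            ← Real.rpow_mul hs0, mul_comm A p]
  refine le_trans (le_of_eq ?_) (setLIntegral_mono' measurableSet_Ioo hin)
  rw [lintegral_mul_const _ (by fun_prop)]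
  congr 1
  rw [← ofReal_integral_eq_lintegral_ofReal]
  · congr 1
    rw [← integral_Ioc_eq_integral_Ioo, ← intervalIntegral.integral_of_le ht.1.le,
      intervalIntegral.integral_const_mul, integral_rpow (Or.inl (by linarith)),
      Real.zero_rpow (by linarith)]
    ring
  · rw [← IntegrableOn, ← integrableOn_Ioc_iff_integrableOn_Ioo,
      ← intervalIntegrable_iff_integrableOn_Ioc_of_le ht.1.le]
    exact (intervalIntegral.intervalIntegrable_rpow' (by linarith)).const_mul _
  · filter_upwards [ae_restrict_mem measurableSet_Ioo] with s hs
    have := hs.1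
    positivity

lemma bnd (N : ℕ) {p : ℝ} (hp : 1 < p) : ∃ D : ℝ, ∀ T : ℝ, 
    ∀ (μ : Measure (HE N)) [SFinite μ] (u : HE N → ℝ → ℝ)
    (hu0 : ∀ x : HE N, ∀ t ∈ Set.Ioo (0:ℝ) T, 0 ≤ u x t)
    (hu : ∀ t ∈ Set.Ioo (0:ℝ) T, ∀ᵐ x : HE N,
          (∫⁻ y, ENNReal.ofReal (heatKernel N (x - y) t) ∂μ) +
            (∫⁻ s in Set.Ioo (0:ℝ) t, ∫⁻ y,
              ENNReal.ofReal (heatKernel N (x - y) (t - s)) * ENNReal.ofReal (u y s ^ p)) ≤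
            ENNReal.ofReal (u x t)),
    ∀ t ∈ Set.Ioo (0:ℝ) T, ∀ᵐ x : HE N,
      VV N μ x t ≤ ENNReal.ofReal (Real.exp D * t ^ (-(1/(p-1)))) := by
  have hp1 : 0 < p - 1 := by linarith
  set β : ℝ := Real.log (p + 1) with hβ
  have hβ0 : 0 < β := Real.log_pos (by linarith)
  set E : ℝ := β / (p - 1) with hE
  set D : ℝ := (β + E) / (p - 1) with hD
  have hE0 : 0 < E := by positivity
  have hD0 : 0 < D := by positivity
  have eE : (p - 1) * E = β := by rw [hE]; field_simp
  have eD : (p - 1) * D = β + E := by rw [hD]; field_simp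
  refine ⟨D, ?_⟩
  intro T μ _ u hu0 hu
  have hA0 : ∀ k : ℕ, 0 ≤ (p ^ k - 1) / (p - 1) := fun k =>
    div_nonneg (by linarith [one_le_pow₀ (n := k) hp.le]) hp1.le
  have hAs : ∀ k : ℕ, p * ((p ^ k - 1) / (p - 1)) + 1 = (p ^ (k+1) - 1) / (p - 1) := by
    intro k; field_simp; ring
  have hAb : ∀ k : ℕ, (p ^ k - 1) / (p - 1) ≤ (p + 1) ^ k := by
    intro k
    induction k with
    | zero => simp
    | succ k ih =>
      rw [← hAs, pow_succ]
      have : 1 ≤ (p+1)^k := one_le_pow₀ (by linarith)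
      nlinarith
  have main : ∀ k : ℕ, ∀ t ∈ Set.Ioo (0:ℝ) T, ∀ᵐ x : HE N,
      ENNReal.ofReal (Real.exp (-(D * p ^ k - E * k - D)) * t ^ ((p ^ k - 1) / (p - 1))) *
        VV N μ x t ^ (p ^ k) ≤ ENNReal.ofReal (u x t) := by
    intro k
    induction k with
    | zero =>
      intro t ht
      filter_upwards [hu t ht] with x hx
      refine le_trans (le_of_eq ?_) (le_trans le_self_add hx)
      simp [VV]
    | succ k ih =>
      intro t ht
      have := step N hp μ u hu0 hu (Real.exp_pos _).le (hA0 k) (one_le_pow₀ hp.le) ih t ht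
      filter_upwards [this] with x hx
      refine le_trans ?_ hx
      rw [hAs, ← pow_succ']
      have ht0 := ht.1.le
      gcongr
      have hpos : 0 < (p ^ (k+1) - 1) / (p - 1) := by
        rw [← hAs]; nlinarith [hA0 k]
      rw [le_div_iff₀ hpos]
      have h3 : (p ^ (k+1) - 1) / (p - 1) ≤ Real.exp (β * (k+1)) := by
        refine (hAb (k+1)).trans (le_of_eq ?_)
        rw [hβ, Real.exp_mul, Real.exp_log (by linarith)]
        exact_mod_cast rfl
      refine (mul_le_mul_of_nonneg_left h3 (Real.exp_pos _).le).trans ?_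
      rw [← Real.exp_add, ← Real.exp_mul, Real.exp_le_exp]
      push_cast
      rw [pow_succ]
      have : (k:ℝ) * ((p - 1) * E) = k * β := by rw [eE]
      nlinarith
  intro t ht
  have hall := (ae_all_iff.2 fun k => main k t ht)
  filter_upwards [hall] with x hx
  have ht0 := ht.1
  have hfin : VV N μ x t ≠ ⊤ := by
    have := hx 0
    simp at this
    exact ne_top_of_le_ne_top ENNReal.ofReal_ne_top this
  obtain ⟨v, hv0, hv⟩ : ∃ v : ℝ, 0 ≤ v ∧ VV N μ x t = ENNReal.ofReal v :=
    ⟨_, ENNReal.toReal_nonneg, (ENNReal.ofReal_toReal hfin).symm⟩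
  rw [hv]
  apply ENNReal.ofReal_le_ofReal
  by_contra hcon
  push Not at hcon
  set w : ℝ := Real.exp (-D) * t ^ (1/(p-1)) * v with hw
  have hw1 : 1 < w := by
    have hm := mul_lt_mul_of_pos_left hcon (show 0 < Real.exp (-D) * t ^ (1/(p-1)) by positivity)
    refine lt_of_eq_of_lt ?_ hm
    rw [Real.exp_neg, Real.rpow_neg ht0.le]
    have := Real.rpow_pos_of_pos ht0 (1/(p-1))
    field_simp
  have hk : ∀ k : ℕ, w ^ (p ^ k) ≤ u x t * t ^ (1/(p-1)) := by
    intro k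
    have h := hx k
    rw [hv, ENNReal.ofReal_rpow_of_nonneg hv0 (by positivity), ← ENNReal.ofReal_mul (by positivity),
      ENNReal.ofReal_le_ofReal_iff (hu0 x t ht)] at h
    have h' := mul_le_mul_of_nonneg_right h (show 0 ≤ t ^ (1/(p-1)) by positivity)
    refine le_trans ?_ h'
    rw [hw, Real.mul_rpow (by positivity) hv0, Real.mul_rpow (by positivity) (by positivity),
      ← Real.exp_mul, ← Real.rpow_mul ht0.le]
    have e1 : t ^ (1/(p-1) * p ^ k) = t ^ ((p ^ k - 1) / (p - 1)) * t ^ (1/(p-1)) := by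
      rw [← Real.rpow_add ht0]; congr 1; field_simp; ring
    rw [e1]
    have e2 : Real.exp (-D * p ^ k) ≤ Real.exp (-(D * p ^ k - E * k - D)) := by
      rw [Real.exp_le_exp]
      have : 0 ≤ E * k := by positivity
      linarith
    calc _ = Real.exp (-D * p ^ k) * (t ^ ((p ^ k - 1) / (p - 1)) * t ^ (1/(p-1)) * v ^ (p ^ k)) := by ring
      _ ≤ Real.exp (-(D * p ^ k - E * k - D)) * (t ^ ((p ^ k - 1) / (p - 1)) * t ^ (1/(p-1)) * v ^ (p ^ k)) := by
        gcongr
      _ = _ := by ring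
  have hlim : Filter.Tendsto (fun k : ℕ => w ^ (p ^ k)) Filter.atTop Filter.atTop :=
    (tendsto_rpow_atTop_of_base_gt_one w hw1).comp (tendsto_pow_atTop_atTop_of_one_lt hp)
  obtain ⟨k, hk'⟩ := (hlim.eventually (Filter.eventually_gt_atTop (u x t * t ^ (1/(p-1))))).exists
  exact absurd (hk k) (not_le.2 hk')

/-- Necessary condition on the initial data for the existence of an integral supersolution
of `∂_t u - Δu = u^p` on `ℝ^N × [0,T)`, in the non-critical case `p ≠ 1 + 2/N`. -/
theorem stmt_17 (N : ℕ) (hN : 1 ≤ N) (p : ℝ) (hp : 1 < p) (hpF : p ≠ 1 + 2 / N) :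
    ∃ γ : ℝ, 0 < γ ∧ ∀ T : ℝ, 0 < T →
      ∀ μ : Measure (EuclideanSpace ℝ (Fin N)), IsFiniteMeasureOnCompacts μ →
      ∀ u : EuclideanSpace ℝ (Fin N) → ℝ → ℝ,
        Measurable (Function.uncurry u) →
        (∀ x : EuclideanSpace ℝ (Fin N), ∀ t ∈ Set.Ioo (0:ℝ) T, 0 ≤ u x t) →
        (∀ t ∈ Set.Ioo (0:ℝ) T, ∀ᵐ x : EuclideanSpace ℝ (Fin N),
          (∫⁻ y, ENNReal.ofReal (heatKernel N (x - y) t) ∂μ) +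
            (∫⁻ s in Set.Ioo (0:ℝ) t, ∫⁻ y,
              ENNReal.ofReal (heatKernel N (x - y) (t - s)) * ENNReal.ofReal (u y s ^ p)) ≤
            ENNReal.ofReal (u x t)) →
      ∀ z : EuclideanSpace ℝ (Fin N), ∀ σ : ℝ, 0 < σ → σ < T ^ ((1:ℝ)/2) →
        μ (Metric.ball z σ) ≤ ENNReal.ofReal (γ * σ ^ ((N:ℝ) - 2 / (p - 1))) := by
  obtain ⟨D, hD⟩ := bnd N hp
  refine ⟨(4 * Real.pi) ^ ((N:ℝ)/2) * Real.exp 1 * Real.exp D, by positivity, ?_⟩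
  intro T hT μ hμ u hum hu0 hu z σ hσ hσT
  have ht : σ ^ 2 ∈ Set.Ioo (0:ℝ) T := by
    refine ⟨by positivity, ?_⟩
    rw [← Real.sqrt_eq_rpow] at hσT
    exact (Real.lt_sqrt hσ.le).1 hσT
  have hae := hD T μ u hu0 hu (σ ^ 2) ht
  obtain ⟨x, hxb, hx⟩ : ∃ x ∈ Metric.ball z σ,
      VV N μ x (σ^2) ≤ ENNReal.ofReal (Real.exp D * (σ^2) ^ (-(1/(p-1)))) := by
    have h1 : (volume : Measure (HE N)) (Metric.ball z σ) ≠ 0 :=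
      (Metric.measure_ball_pos volume z hσ).ne'
    have h2 := (Measure.ae_le_iff_absolutelyContinuous.2
      (Measure.absolutelyContinuous_of_le (Measure.restrict_le_self (μ := (volume : Measure (HE N))) (s := Metric.ball z σ)))) hae
    have h3 := ae_restrict_mem (μ := (volume : Measure (HE N))) (Metric.isOpen_ball (x := z) (ε := σ)).measurableSet
    have : (ae ((volume : Measure (HE N)).restrict (Metric.ball z σ))).NeBot := by
      rw [ae_neBot]; simpa [Measure.restrict_eq_zero] using h1
    obtain ⟨x, h⟩ := (h3.and h2).exists
    exact ⟨x, h.1, h.2⟩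
  set K : ℝ := (4 * Real.pi * σ^2) ^ (-(N:ℝ)/2) * Real.exp (-1) with hK
  have hKpos : 0 < K := by positivity
  have hlow : ENNReal.ofReal K * μ (Metric.ball z σ) ≤ VV N μ x (σ^2) := by
    unfold VV
    rw [← setLIntegral_const]
    refine le_trans ?_ (setLIntegral_le_lintegral (Metric.ball z σ) _)
    refine setLIntegral_mono' Metric.isOpen_ball.measurableSet ?_
    intro y hy
    apply ENNReal.ofReal_le_ofReal
    unfold heatKernel
    rw [hK]
    gcongr
    have h4 : ‖x - y‖ ≤ 2 * σ := by
      rw [← dist_eq_norm]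
      have := dist_triangle_right x y z
      rw [Metric.mem_ball] at hxb hy
      linarith
    rw [le_div_iff₀ (by positivity)]
    nlinarith [norm_nonneg (x - y)]
  have h5 := hlow.trans hx
  have h6 : μ (Metric.ball z σ) = ENNReal.ofReal K⁻¹ * (ENNReal.ofReal K * μ (Metric.ball z σ)) := by
    rw [← mul_assoc, ← ENNReal.ofReal_mul (by positivity), inv_mul_cancel₀ hKpos.ne',
      ENNReal.ofReal_one, one_mul]
  rw [h6]
  refine (mul_le_mul_right h5 _).trans (le_of_eq ?_)
  rw [← ENNReal.ofReal_mul (by positivity)]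
  congr 1
  have hs2 : ∀ r : ℝ, (σ^2) ^ r = σ ^ (2 * r) := by
    intro r; rw [Real.rpow_mul hσ.le, Real.rpow_two]
  rw [hK, mul_inv, neg_div, Real.rpow_neg (by positivity), inv_inv, Real.exp_neg, inv_inv,
    Real.mul_rpow (by positivity) (by positivity), hs2, hs2, sub_eq_add_neg (N:ℝ), Real.rpow_add hσ]
  have e1 : 2 * ((N:ℝ)/2) = N := by ring
  have e2 : 2 * (-(1/(p-1))) = -(2/(p-1)) := by ring
  rw [e1, e2]; ring
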